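/- Let (G,Λ) be a self-similar k-graph, let T be a maximal tail of Λ, let x be a cofinal infinite path of ΛT, and let f̃ : ℤ^k → 𝕋 be a group homomorphism into the circle group. On the Hilbert space ℓ²([x]) with orthonormal basis {δ_y : y ∈ [x]}, define for μ ∈ ΛT the operator S_μ by S_μ δ_y = f̃(d(μ)) δ_{μy} if s(μ) = y(0,0) and S_μ δ_y = 0 otherwise, and for g ∈ G the operator U_g by U_g δ_y = δ_{g·y}. Then each S_μ extends to a bounded operator which is a partial isometry, each U_g extends to a unitary operator, and these operators satisfy: (1) {S_v}_{v ∈ T} are mutually orthogonal projections; (2) S_{μν} = S_μ S_ν whenever s(μ) = r(ν); (3) S_μ* S_μ = S_{s(μ)}; (4) S_v = Σ_{μ ∈ vΛ^pT} S_μ S_μ* for all v ∈ T and p ∈ ℕ^k; (5) U_{gh} = U_g U_h; (6) U_g S_μ = S_{g·μ} U_{g|_μ}. -/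

import Mathlib

/-- A `k`-graph: a countable small category equipped with a degree functor
`d : Λ → ℕ^k` satisfying the unique factorization property.  Objects are
identified with their identity morphisms (the degree-zero paths);
`comp μ ν` is the composite `μν` (a junk value when `s μ ≠ r ν`). -/
structure KGraph (k : ℕ) where
  Path : Type
  countable : Countable Path
  r : Path → Path
  s : Path → Path
  d : Path → Fin k → ℕ
  comp : Path → Path → Path
  d_r : ∀ μ, d (r μ) = 0
  d_s : ∀ μ, d (s μ) = 0
  r_r : ∀ μ, r (r μ) = r μ
  s_r : ∀ μ, s (r μ) = r μ
  r_s : ∀ μ, r (s μ) = s μ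
  s_s : ∀ μ, s (s μ) = s μ
  eq_r_of_d_eq_zero : ∀ μ, d μ = 0 → μ = r μ
  comp_id : ∀ μ, comp μ (s μ) = μ
  id_comp : ∀ μ, comp (r μ) μ = μ
  r_comp : ∀ μ ν, s μ = r ν → r (comp μ ν) = r μ
  s_comp : ∀ μ ν, s μ = r ν → s (comp μ ν) = s ν
  d_comp : ∀ μ ν, s μ = r ν → d (comp μ ν) = d μ + d ν
  comp_assoc : ∀ μ ν ξ, s μ = r ν → s ν = r ξ →
    comp (comp μ ν) ξ = comp μ (comp ν ξ)
  factor : ∀ μ p q, d μ = p + q →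
    ∃! αβ : Path × Path, s αβ.1 = r αβ.2 ∧ d αβ.1 = p ∧ d αβ.2 = q ∧
      comp αβ.1 αβ.2 = μ

namespace KGraph

variable {k : ℕ} (Λ : KGraph k)

/-- The vertices of a `k`-graph are the degree-zero paths. -/
def IsVertex (v : Λ.Path) : Prop := Λ.d v = 0

/-- `Λ` is row-finite if `|v Λ^p| < ∞` for every vertex `v` and `p ∈ ℕ^k`. -/
def RowFinite : Prop :=
  ∀ v, Λ.IsVertex v → ∀ p : Fin k → ℕ, {μ | Λ.r μ = v ∧ Λ.d μ = p}.Finite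

/-- `Λ` is source-free if `v Λ^p ≠ ∅` for every vertex `v` and `p ∈ ℕ^k`. -/
def SourceFree : Prop :=
  ∀ v, Λ.IsVertex v → ∀ p : Fin k → ℕ, ∃ μ, Λ.r μ = v ∧ Λ.d μ = p

/-- `ΛT`, the set of paths of `Λ` whose source lies in `T`. -/
def tailPaths (T : Set Λ.Path) : Set Λ.Path := {μ | Λ.s μ ∈ T}

/-- `H Λ T`, the set of paths with source in `T` and range in `H`. -/
def cornerPaths (T H : Set Λ.Path) : Set Λ.Path := {μ | Λ.s μ ∈ T ∧ Λ.r μ ∈ H}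

end KGraph

/-- A maximal tail of a `k`-graph. -/
structure MaximalTail {k : ℕ} (Λ : KGraph k) (T : Set Λ.Path) : Prop where
  nonempty : T.Nonempty
  vertex : ∀ v ∈ T, Λ.IsVertex v
  backward_closed : ∀ w, Λ.IsVertex w → ∀ v ∈ T, (∃ μ, Λ.r μ = w ∧ Λ.s μ = v) → w ∈ T
  reaches : ∀ v ∈ T, ∀ p : Fin k → ℕ, ∃ μ, Λ.r μ = v ∧ Λ.d μ = p ∧ Λ.s μ ∈ T
  directed : ∀ v₁ ∈ T, ∀ v₂ ∈ T, ∃ w ∈ T,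
    (∃ μ, Λ.r μ = v₁ ∧ Λ.s μ = w) ∧ (∃ ν, Λ.r ν = v₂ ∧ Λ.s ν = w)

/-- An infinite path of a `k`-graph, i.e. a degree-preserving functor
`x : Ω_k → Λ`; here `val p n` records the segment `x(p, p + n)`. -/
structure InfPath {k : ℕ} (Λ : KGraph k) where
  val : (Fin k → ℕ) → (Fin k → ℕ) → Λ.Path
  d_val : ∀ p n, Λ.d (val p n) = n
  r_val : ∀ p n, Λ.r (val p n) = val p 0
  s_val : ∀ p n, Λ.s (val p n) = val (p + n) 0
  comp_val : ∀ p m n, Λ.comp (val p m) (val (p + m) n) = val p (m + n)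

namespace InfPath

variable {k : ℕ} {Λ : KGraph k}

/-- The shift `σ^n x` of an infinite path. -/
def shift (x : InfPath Λ) (n : Fin k → ℕ) : InfPath Λ where
  val p m := x.val (p + n) m
  d_val p m := x.d_val _ _
  r_val p m := x.r_val _ _
  s_val p m := by rw [x.s_val, add_right_comm]
  comp_val p m m' := by
    show Λ.comp (x.val (p + n) m) (x.val (p + m + n) m') = x.val (p + n) (m + m')
    rw [add_right_comm p m n]; exact x.comp_val (p + n) m m'

/-- An infinite path lies in the subgraph determined by the set of paths `P`
if all of its segments lie in `P`. -/
def inSub (P : Set Λ.Path) (x : InfPath Λ) : Prop := ∀ p n, x.val p n ∈ P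

end InfPath

/-- `z = μ x`: `z` is the infinite path obtained by prepending the finite
path `μ` to the infinite path `x` (which requires `s μ = x(0,0)`). -/
def KGraph.IsExtension {k : ℕ} (Λ : KGraph k) (μ : Λ.Path) (x z : InfPath Λ) : Prop :=
  Λ.s μ = x.val 0 0 ∧ ∀ n, z.val 0 (Λ.d μ + n) = Λ.comp μ (x.val 0 n)

/-- A cycline pair `(μ, 1, ν)` of the subgraph of `Λ` determined by the set of
paths `P`: `s μ = s ν` and `μ x = ν x` for every infinite path `x` of the
subgraph with range `s ν`. -/
def KGraph.IsCyclinePair {k : ℕ} (Λ : KGraph k) (P : Set Λ.Path) (μ ν : Λ.Path) : Prop :=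
  μ ∈ P ∧ ν ∈ P ∧ Λ.s μ = Λ.s ν ∧
    ∀ x : InfPath Λ, x.inSub P →
      ∀ z : InfPath Λ, Λ.IsExtension ν x z → Λ.IsExtension μ x z

/-- `Per_Γ` for the subgraph `Γ` of `Λ` determined by `P`:
the set of all `d μ − d ν` over cycline pairs `(μ, 1, ν)`. -/
def KGraph.PerPair {k : ℕ} (Λ : KGraph k) (P : Set Λ.Path) : Set (Fin k → ℤ) :=
  {m | ∃ μ ν, Λ.IsCyclinePair P μ ν ∧ m = fun i => (Λ.d μ i : ℤ) - (Λ.d ν i : ℤ)}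

/-- A self-similar `k`-graph `(G, Λ)`: an action of the countable discrete
group `G` on `Λ` together with a restriction map `(g, μ) ↦ g|_μ`. -/
structure SelfSimilarSys (k : ℕ) (G : Type) [Group G] [Countable G] (Λ : KGraph k) where
  act : G → Λ.Path → Λ.Path
  res : G → Λ.Path → G
  act_one : ∀ μ, act 1 μ = μ
  act_mul : ∀ g h μ, act (g * h) μ = act g (act h μ)
  d_act : ∀ g μ, Λ.d (act g μ) = Λ.d μ
  s_act : ∀ g μ, Λ.s (act g μ) = act g (Λ.s μ)
  r_act : ∀ g μ, Λ.r (act g μ) = act g (Λ.r μ)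
  act_comp : ∀ g μ ν, Λ.s μ = Λ.r ν →
    act g (Λ.comp μ ν) = Λ.comp (act g μ) (act (res g μ) ν)
  res_vertex : ∀ g v, Λ.IsVertex v → res g v = g
  res_comp : ∀ g μ ν, Λ.s μ = Λ.r ν → res g (Λ.comp μ ν) = res (res g μ) ν
  res_one : ∀ μ, res 1 μ = 1
  res_mul : ∀ g h μ, res (g * h) μ = res g (act h μ) * res h μ

namespace SelfSimilarSys

variable {k : ℕ} {G : Type} [Group G] [Countable G] {Λ : KGraph k}

/-- `(G, Λ)` is pseudo free: `g·μ = μ` and `g|_μ = 1` imply `g = 1`. -/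
def PseudoFree (S : SelfSimilarSys k G Λ) : Prop :=
  ∀ g μ, S.act g μ = μ → S.res g μ = 1 → g = 1

/-- `y = g · x` for infinite paths: `y(0, n) = g · x(0, n)` for all `n`. -/
def IsGAct (S : SelfSimilarSys k G Λ) (g : G) (x y : InfPath Λ) : Prop :=
  ∀ n, y.val 0 n = S.act g (x.val 0 n)

/-- A cycline triple `(μ, g, ν)` of the subgraph of `Λ` determined by `P`:
`s μ = g · s ν` and `μ (g · x) = ν x` for every infinite path `x` of the
subgraph with range `s ν`. -/
def IsCyclineTriple (S : SelfSimilarSys k G Λ) (P : Set Λ.Path)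
    (μ : Λ.Path) (g : G) (ν : Λ.Path) : Prop :=
  μ ∈ P ∧ ν ∈ P ∧ Λ.s μ = S.act g (Λ.s ν) ∧
    ∀ x : InfPath Λ, x.inSub P → Λ.s ν = x.val 0 0 →
      ∀ y : InfPath Λ, S.IsGAct g x y →
        ∀ z : InfPath Λ, Λ.IsExtension ν x z → Λ.IsExtension μ y z

/-- `Per_{G,Γ}` for the subgraph `Γ` of `Λ` determined by `P`:
the set of all `d μ − d ν` over cycline triples `(μ, g, ν)`. -/
def PerTriple (S : SelfSimilarSys k G Λ) (P : Set Λ.Path) : Set (Fin k → ℤ) :=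
  {m | ∃ μ g ν, S.IsCyclineTriple P μ g ν ∧ m = fun i => (Λ.d μ i : ℤ) - (Λ.d ν i : ℤ)}

/-- Membership `y ∈ [x]`: `y` is an infinite path of `ΛT` and
`σ^p x = g · σ^q y` for some `p, q ∈ ℕ^k` and `g ∈ G`. -/
def ClassMem (S : SelfSimilarSys k G Λ) (T : Set Λ.Path) (x y : InfPath Λ) : Prop :=
  y.inSub (Λ.tailPaths T) ∧ ∃ p q : Fin k → ℕ, ∃ g : G, S.IsGAct g (y.shift q) (x.shift p)

end SelfSimilarSys

/-- `H_T`: the vertices `v ∈ T` such that for all `p, q ∈ ℕ^k` with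
`p − q ∈ Per_{ΛT}` and every `μ ∈ v Λ^p T` there is a unique `ν ∈ v Λ^q T`
with `(μ, 1, ν)` a cycline pair of `ΛT`. -/
def KGraph.HSet {k : ℕ} (Λ : KGraph k) (T : Set Λ.Path) : Set Λ.Path :=
  {v | v ∈ T ∧ ∀ p q : Fin k → ℕ,
    (fun i => (p i : ℤ) - (q i : ℤ)) ∈ Λ.PerPair (Λ.tailPaths T) →
      ∀ μ, Λ.r μ = v → Λ.d μ = p → Λ.s μ ∈ T →
        ∃! ν, Λ.r ν = v ∧ Λ.d ν = q ∧ Λ.IsCyclinePair (Λ.tailPaths T) μ ν}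

open scoped Classical

/-- The class `[x]`, as an index type. -/
def ClsIdx {k : ℕ} {G : Type} [Group G] [Countable G] {Λ : KGraph k}
    (S : SelfSimilarSys k G Λ) (T : Set Λ.Path) (x : InfPath Λ) : Type :=
  {y : InfPath Λ // S.ClassMem T x y}

/-- The Hilbert space `ℓ²([x])`. -/
noncomputable abbrev ClsH {k : ℕ} {G : Type} [Group G] [Countable G] {Λ : KGraph k}
    (S : SelfSimilarSys k G Λ) (T : Set Λ.Path) (x : InfPath Λ) : Type :=
  lp (fun _ : ClsIdx S T x => ℂ) 2

/-- The basis vector `δ_y` of `ℓ²([x])`. -/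
noncomputable def delta {k : ℕ} {G : Type} [Group G] [Countable G] {Λ : KGraph k}
    (S : SelfSimilarSys k G Λ) (T : Set Λ.Path) (x : InfPath Λ)
    (y : ClsIdx S T x) : ClsH S T x :=
  lp.single 2 y (1 : ℂ)

section PEquivOperator

variable {ι : Type*}

theorem PEquiv.sum_symm_elim (e : ι ≃. ι) (F : ι → ℝ) (s : Finset ι) :
    ∑ z ∈ s, (e.symm z).elim 0 F =
      ∑ y ∈ s.filterMap e.symm fun _ _ _ h h' => e.symm.inj h h', F y := by
  have key : ∀ z, (e.symm z).elim 0 F ≠ 0 → ∃ y, e.symm z = some y := by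
    intro z hz
    cases h : e.symm z with
    | none => simp [h] at hz
    | some y => exact ⟨y, rfl⟩
  refine Finset.sum_bij_ne_zero (fun z _ hz => (key z hz).choose) ?_ ?_ ?_ ?_
  · intro z hz hne
    exact (Finset.mem_filterMap _).2 ⟨z, hz, (key z hne).choose_spec⟩
  · intro z hz hne z' hz' hne' h
    have h₁ := (key z hne).choose_spec
    have h₂ := (key z' hne').choose_spec
    rw [← h] at h₂
    exact e.symm.inj h₁ h₂
  · intro y hy hne
    obtain ⟨z, hz, h⟩ := (Finset.mem_filterMap _).1 hy
    have hz0 : (e.symm z).elim 0 F ≠ 0 := by simpa [h] using hne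
    refine ⟨z, hz, hz0, ?_⟩
    have h₁ := (key z hz0).choose_spec
    exact Option.some.inj (h₁.symm.trans h)
  · intro z hz hne
    have h₁ := (key z hne).choose_spec
    conv_lhs => rw [h₁]
    rfl

theorem PEquiv.sum_norm_symm_elim_le (e : ι ≃. ι) (ξ : lp (fun _ : ι => ℂ) 2) (s : Finset ι) :
    ∑ z ∈ s, ‖((e.symm z).elim 0 ξ : ℂ)‖ ^ (2 : ENNReal).toReal ≤
      ‖ξ‖ ^ (2 : ENNReal).toReal := by
  have h : ∀ z, ‖((e.symm z).elim 0 ξ : ℂ)‖ ^ (2 : ENNReal).toReal =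
      (e.symm z).elim 0 fun y => ‖ξ y‖ ^ (2 : ENNReal).toReal := by
    intro z
    cases e.symm z <;> simp
  simp only [h, e.sum_symm_elim]
  exact lp.sum_rpow_le_norm_rpow (by simp) ξ _

/-- The operator on `ℓ²(ι)` mapping the basis vector at `y` to the one at `e y`, or to `0` when
`e y` is undefined. -/
noncomputable def PEquiv.lpOperator (e : ι ≃. ι) :
    lp (fun _ : ι => ℂ) 2 →L[ℂ] lp (fun _ : ι => ℂ) 2 :=
  LinearMap.mkContinuous
    { toFun := fun ξ => ⟨fun z => (e.symm z).elim 0 ξ, memℓp_gen' (e.sum_norm_symm_elim_le ξ)⟩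
      map_add' := by
        intro ξ η
        ext z
        simp only [lp.coeFn_add, Pi.add_apply]
        cases e.symm z <;> simp
      map_smul' := by
        intro c ξ
        ext z
        simp only [lp.coeFn_smul, Pi.smul_apply, RingHom.id_apply]
        cases e.symm z <;> simp } 1
    (fun ξ => lp.norm_le_of_forall_sum_le (by simp) (by simp)
      (by rw [one_mul]; exact e.sum_norm_symm_elim_le ξ))

theorem PEquiv.lpOperator_apply (e : ι ≃. ι) (ξ : lp (fun _ : ι => ℂ) 2) (z : ι) :
    e.lpOperator ξ z = (e.symm z).elim 0 ξ := rfl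

theorem PEquiv.lpOperator_trans (e e' : ι ≃. ι) :
    (e.trans e').lpOperator = e'.lpOperator * e.lpOperator := by
  ext ξ z
  change ((e'.symm z).bind e.symm).elim 0 ξ = (e'.symm z).elim 0 (e.lpOperator ξ)
  cases e'.symm z <;> rfl

theorem PEquiv.lpOperator_refl : (PEquiv.refl ι).lpOperator = 1 := by
  ext ξ z
  rfl

theorem PEquiv.lpOperator_bot : (⊥ : ι ≃. ι).lpOperator = 0 := by
  ext ξ z
  rfl

theorem PEquiv.lpOperator_ofSet_apply (s : Set ι) (ξ : lp (fun _ : ι => ℂ) 2) (z : ι) :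
    (PEquiv.ofSet s).lpOperator ξ z = if z ∈ s then ξ z else 0 := by
  rw [PEquiv.lpOperator_apply, PEquiv.ofSet_symm]
  change (if z ∈ s then some z else none).elim 0 ξ = _
  split_ifs <;> rfl

theorem PEquiv.lpOperator_single_of_eq_some {e : ι ≃. ι} {y z : ι} (h : e y = some z) :
    e.lpOperator (lp.single 2 y 1) = lp.single 2 z 1 := by
  ext w
  rw [PEquiv.lpOperator_apply, lp.single_apply]
  by_cases hw : w = z
  · subst hw
    rw [e.eq_some_iff.2 h]
    simp [lp.single_apply]
  · rw [Pi.single_eq_of_ne hw]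
    cases h' : e.symm w with
    | none => rfl
    | some y' =>
      have hy : y' ≠ y := by
        rintro rfl
        rw [e.eq_some_iff, h] at h'
        exact hw (Option.some.inj h').symm
      exact lp.single_apply_ne 2 y 1 hy

theorem PEquiv.lpOperator_single_of_eq_none {e : ι ≃. ι} {y : ι} (h : e y = none) :
    e.lpOperator (lp.single 2 y 1) = 0 := by
  ext w
  rw [PEquiv.lpOperator_apply]
  cases h' : e.symm w with
  | none => rfl
  | some y' =>
    have hy : y' ≠ y := by
      rintro rfl
      rw [e.eq_some_iff, h] at h'
      cases h'
    exact lp.single_apply_ne 2 y 1 hy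

theorem PEquiv.adjoint_lpOperator (e : ι ≃. ι) :
    ContinuousLinearMap.adjoint e.lpOperator = e.symm.lpOperator := by
  refine ((ContinuousLinearMap.eq_adjoint_iff _ _).2 fun ξ η => ?_).symm
  simp only [lp.inner_eq_tsum, PEquiv.lpOperator_apply, PEquiv.symm_symm]
  have key : ∀ y : Function.support fun y => inner ℂ (ξ y) ((e.symm y).elim 0 η : ℂ),
      ∃ z, e.symm y = some z := by
    rintro ⟨y, hy⟩
    cases h : e.symm y with
    | none => simp [h] at hy
    | some z => exact ⟨z, rfl⟩
  choose i hi using key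
  refine tsum_eq_tsum_of_ne_zero_bij i ?_ ?_ ?_
  · intro y y' h
    have h₁ := hi y
    have h₂ := hi y'
    rw [← h] at h₂
    exact Subtype.ext (e.symm.inj h₁ h₂)
  · intro z hz
    rw [Function.mem_support] at hz
    cases h : e z with
    | none => simp [h] at hz
    | some y =>
      have hy : e.symm y = some z := e.eq_some_iff.2 h
      refine ⟨⟨y, by simpa [h, hy] using hz⟩, ?_⟩
      have h₁ := hi ⟨y, by simpa [h, hy] using hz⟩
      exact Option.some.inj (h₁.symm.trans hy)
  · intro y
    have h₁ := hi y
    rw [h₁, e.eq_some_iff.1 h₁]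
    rfl

end PEquivOperator

namespace KGraph

variable {k : ℕ} {Λ : KGraph k}

theorem IsVertex.r_eq {v : Λ.Path} (hv : Λ.IsVertex v) : Λ.r v = v :=
  (Λ.eq_r_of_d_eq_zero v hv).symm

theorem IsVertex.s_eq {v : Λ.Path} (hv : Λ.IsVertex v) : Λ.s v = v := by
  rw [← hv.r_eq, Λ.s_r]

theorem isVertex_s (μ : Λ.Path) : Λ.IsVertex (Λ.s μ) := Λ.d_s μ

theorem isVertex_r (μ : Λ.Path) : Λ.IsVertex (Λ.r μ) := Λ.d_r μ

theorem comp_inj {α β α' β' : Λ.Path} (h : Λ.s α = Λ.r β) (h' : Λ.s α' = Λ.r β')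
    (hd : Λ.d α = Λ.d α') (he : Λ.comp α β = Λ.comp α' β') : α = α' ∧ β = β' := by
  have hd' : Λ.d β = Λ.d β' := by
    have := Λ.d_comp α β h
    rw [he, Λ.d_comp α' β' h', hd] at this
    exact (add_left_cancel this).symm
  have := (Λ.factor (Λ.comp α β) (Λ.d α) (Λ.d β) (Λ.d_comp α β h)).unique
    (y₁ := (α, β)) (y₂ := (α', β')) ⟨h, rfl, rfl, rfl⟩ ⟨h', hd.symm, hd'.symm, he.symm⟩
  exact ⟨congrArg Prod.fst this, congrArg Prod.snd this⟩

/-- `μ` is an initial segment of `ξ`. -/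
def IsPrefix (Λ : KGraph k) (μ ξ : Λ.Path) : Prop := ∃ ν, Λ.s μ = Λ.r ν ∧ Λ.comp μ ν = ξ

theorem isPrefix_comp {μ ν : Λ.Path} (h : Λ.s μ = Λ.r ν) : Λ.IsPrefix μ (Λ.comp μ ν) :=
  ⟨ν, h, rfl⟩

theorem IsPrefix.trans {μ ν ξ : Λ.Path} (h : Λ.IsPrefix μ ν) (h' : Λ.IsPrefix ν ξ) :
    Λ.IsPrefix μ ξ := by
  obtain ⟨α, hα, rfl⟩ := h
  obtain ⟨β, hβ, rfl⟩ := h'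
  rw [Λ.s_comp _ _ hα] at hβ
  exact ⟨Λ.comp α β, by rw [Λ.r_comp _ _ hβ, hα], (Λ.comp_assoc _ _ _ hα hβ).symm⟩

theorem IsPrefix.eq_of_d_eq {μ ν ξ : Λ.Path} (h : Λ.IsPrefix μ ξ) (h' : Λ.IsPrefix ν ξ)
    (hd : Λ.d μ = Λ.d ν) : μ = ν := by
  obtain ⟨α, hα, rfl⟩ := h
  obtain ⟨β, hβ, hβ'⟩ := h'
  exact (comp_inj hα hβ hd hβ'.symm).1

theorem exists_isPrefix {ξ : Λ.Path} {p q : Fin k → ℕ} (h : Λ.d ξ = p + q) :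
    ∃ μ, Λ.IsPrefix μ ξ ∧ Λ.d μ = p := by
  obtain ⟨⟨α, β⟩, ⟨h₁, h₂, -, h₄⟩, -⟩ := Λ.factor ξ p q h
  exact ⟨α, ⟨β, h₁, h₄⟩, h₂⟩

theorem IsPrefix.of_le {μ ν ξ : Λ.Path} (h : Λ.IsPrefix μ ξ) (h' : Λ.IsPrefix ν ξ)
    {q : Fin k → ℕ} (hd : Λ.d ν = Λ.d μ + q) : Λ.IsPrefix μ ν := by
  obtain ⟨α, hα, hαd⟩ := exists_isPrefix hd
  rwa [h.eq_of_d_eq (hα.trans h') hαd.symm]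

end KGraph

namespace InfPath

variable {k : ℕ} {Λ : KGraph k}

theorem composable (x : InfPath Λ) (p m n : Fin k → ℕ) :
    Λ.s (x.val p m) = Λ.r (x.val (p + m) n) := by
  rw [x.s_val, x.r_val]

theorem isVertex_val (x : InfPath Λ) (p : Fin k → ℕ) : Λ.IsVertex (x.val p 0) := x.d_val p 0

theorem val_zero_add (x : InfPath Λ) (m n : Fin k → ℕ) :
    Λ.comp (x.val 0 m) (x.val m n) = x.val 0 (m + n) := by
  simpa using x.comp_val 0 m n

theorem composable_zero (x : InfPath Λ) (m n : Fin k → ℕ) :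
    Λ.s (x.val 0 m) = Λ.r (x.val m n) := by
  simpa using x.composable 0 m n

theorem isPrefix_val (x : InfPath Λ) (m n : Fin k → ℕ) :
    Λ.IsPrefix (x.val 0 m) (x.val 0 (m + n)) :=
  ⟨_, x.composable_zero m n, x.val_zero_add m n⟩

theorem ext_val {x y : InfPath Λ} (h : ∀ p n, x.val p n = y.val p n) : x = y := by
  cases x
  cases y
  congr
  funext p n
  exact h p n

theorem ext_zero {x y : InfPath Λ} (h : ∀ n, x.val 0 n = y.val 0 n) : x = y := by
  refine ext_val fun p n => ?_
  refine (KGraph.comp_inj (x.composable_zero p n) (y.composable_zero p n) ?_ ?_).2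
  · rw [x.d_val, y.d_val]
  · rw [x.val_zero_add, y.val_zero_add, h]

theorem ext_cofinal {x y : InfPath Λ} (d : Fin k → ℕ)
    (h : ∀ n, x.val 0 (d + n) = y.val 0 (d + n)) : x = y := by
  refine ext_zero fun n => ?_
  have hx := x.isPrefix_val n d
  have hy := y.isPrefix_val n d
  rw [add_comm n d] at hx hy
  rw [h n] at hx
  exact hx.eq_of_d_eq hy (by rw [x.d_val, y.d_val])

theorem inSub_tailPaths_iff {T : Set Λ.Path} {x : InfPath Λ} :
    x.inSub (Λ.tailPaths T) ↔ ∀ n, x.val n 0 ∈ T := by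
  constructor
  · intro h n
    have := h n 0
    change Λ.s (x.val n 0) ∈ T at this
    rwa [x.s_val, add_zero] at this
  · intro h p n
    change Λ.s (x.val p n) ∈ T
    rw [x.s_val]
    exact h _

/-- A coherent family of finite paths, one of each degree, is the family of initial segments of
an infinite path. -/
theorem exists_of_isPrefix (w : (Fin k → ℕ) → Λ.Path) (hd : ∀ n, Λ.d (w n) = n)
    (hw : ∀ m n, Λ.IsPrefix (w m) (w (m + n))) : ∃ x : InfPath Λ, ∀ n, x.val 0 n = w n := by
  choose t ht hc using hw
  have hdt : ∀ p n, Λ.d (t p n) = n := by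
    intro p n
    have := Λ.d_comp _ _ (ht p n)
    rw [hc, hd, hd] at this
    exact (add_left_cancel this).symm
  have hr : ∀ p n, Λ.r (t p n) = t p 0 := by
    intro p n
    rw [← ht p n, ht p 0]
    exact KGraph.IsVertex.r_eq (hdt p 0)
  have hsw : ∀ p, Λ.s (w p) = t p 0 := fun p => by rw [ht p 0, hr]
  have hs : ∀ p n, Λ.s (t p n) = t (p + n) 0 := by
    intro p n
    rw [← hsw, ← hc p n, Λ.s_comp _ _ (ht p n)]
  have hw0 : Λ.s (w 0) = w 0 := KGraph.IsVertex.s_eq (hd 0)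
  refine ⟨⟨t, hdt, hr, hs, ?_⟩, ?_⟩
  · intro p m n
    have h₁ : Λ.s (t p m) = Λ.r (t (p + m) n) := by rw [hs, hr]
    refine (KGraph.comp_inj (α := w p) (α' := w p) ?_ (ht p (m + n)) rfl ?_).2
    · rw [Λ.r_comp _ _ h₁, ht p m]
    · rw [← Λ.comp_assoc _ _ _ (ht p m) h₁, hc, hc, hc, add_assoc]
  · intro n
    have h₁ := hc 0 n
    have h₂ : Λ.comp (w 0) (t 0 n) = t 0 n := by
      have := Λ.id_comp (t 0 n)
      rwa [hr, ← hsw, hw0] at this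
    rw [h₂, zero_add] at h₁
    exact h₁

theorem exists_isExtension {μ : Λ.Path} {x : InfPath Λ} (h : Λ.s μ = x.val 0 0) :
    ∃ z : InfPath Λ, Λ.IsExtension μ x z := by
  have hc : ∀ n, Λ.s μ = Λ.r (x.val 0 n) := fun n => by rw [x.r_val, h]
  have hd : ∀ n, Λ.d (Λ.comp μ (x.val 0 n)) = Λ.d μ + n := fun n => by
    rw [Λ.d_comp _ _ (hc n), x.d_val]
  have hp : ∀ m n, Λ.IsPrefix (Λ.comp μ (x.val 0 m)) (Λ.comp μ (x.val 0 (m + n))) := by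
    intro m n
    rw [← x.val_zero_add, ← Λ.comp_assoc _ _ _ (hc m) (x.composable_zero m n)]
    exact KGraph.isPrefix_comp (by rw [Λ.s_comp _ _ (hc m), x.composable_zero m n])
  have hpre : ∀ n, ∃ α, Λ.IsPrefix α (Λ.comp μ (x.val 0 n)) ∧ Λ.d α = n := fun n =>
    KGraph.exists_isPrefix (q := Λ.d μ) (by rw [hd, add_comm])
  choose w hw hwd using hpre
  obtain ⟨z, hz⟩ := exists_of_isPrefix w hwd (by
    intro m n
    exact ((hw m).trans (hp m n)).of_le (hw (m + n)) (q := n) (by rw [hwd, hwd]))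
  refine ⟨z, h, fun n => ?_⟩
  rw [hz]
  refine (hw (Λ.d μ + n)).eq_of_d_eq ?_ (by rw [hwd, hd])
  rw [add_comm]
  exact hp n (Λ.d μ)

end InfPath

namespace KGraph

variable {k : ℕ} {Λ : KGraph k} {μ ν : Λ.Path} {x y z : InfPath Λ}

theorem IsExtension.unique (h : Λ.IsExtension μ x y) (h' : Λ.IsExtension μ x z) : y = z :=
  InfPath.ext_cofinal (Λ.d μ) fun n => by rw [h.2, h'.2]

theorem IsExtension.val_d (h : Λ.IsExtension μ x z) : z.val 0 (Λ.d μ) = μ := by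
  have := h.2 0
  rwa [add_zero, ← h.1, Λ.comp_id] at this

theorem IsExtension.shift_eq (h : Λ.IsExtension μ x z) : z.shift (Λ.d μ) = x := by
  refine InfPath.ext_zero fun n => ?_
  change z.val (0 + Λ.d μ) n = x.val 0 n
  rw [zero_add]
  refine (comp_inj (α := z.val 0 (Λ.d μ)) (α' := μ) (z.composable_zero _ _) ?_ ?_ ?_).2
  · rw [h.1, x.r_val]
  · rw [z.d_val]
  · rw [z.val_zero_add, h.2]

theorem isExtension_shift (z : InfPath Λ) (p : Fin k → ℕ) :
    Λ.IsExtension (z.val 0 p) (z.shift p) z := by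
  refine ⟨?_, fun n => ?_⟩
  · rw [z.s_val, zero_add]
    change z.val p 0 = z.val (0 + p) 0
    rw [zero_add]
  · rw [z.d_val, ← z.val_zero_add]
    change _ = Λ.comp _ (z.val (0 + p) n)
    rw [zero_add]

theorem isExtension_shift_of_eq (h : z.val 0 (Λ.d μ) = μ) :
    Λ.IsExtension μ (z.shift (Λ.d μ)) z := by
  have := isExtension_shift z (Λ.d μ)
  rwa [h] at this

theorem IsExtension.val_zero (h : Λ.IsExtension μ x z) : z.val 0 0 = Λ.r μ := by
  rw [← z.r_val 0 (Λ.d μ), h.val_d]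

theorem IsExtension.comp (hν : Λ.IsExtension ν x y) (hμ : Λ.IsExtension μ y z)
    (h : Λ.s μ = Λ.r ν) : Λ.IsExtension (Λ.comp μ ν) x z := by
  refine ⟨by rw [Λ.s_comp _ _ h, hν.1], fun n => ?_⟩
  rw [Λ.d_comp _ _ h, add_assoc, hμ.2, hν.2, Λ.comp_assoc _ _ _ h (by rw [hν.1, x.r_val])]

theorem isExtension_vertex (x : InfPath Λ) : Λ.IsExtension (x.val 0 0) x x := by
  refine ⟨by rw [x.s_val, add_zero], fun n => ?_⟩
  rw [x.d_val, zero_add, x.val_zero_add, zero_add]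

end KGraph

theorem InfPath.shift_shift {k : ℕ} {Λ : KGraph k} (x : InfPath Λ) (m n : Fin k → ℕ) :
    (x.shift m).shift n = x.shift (n + m) :=
  InfPath.ext_val fun p _ => by
    change x.val (p + n + m) _ = x.val (p + (n + m)) _
    rw [add_assoc]

namespace SelfSimilarSys

variable {k : ℕ} {G : Type} [Group G] [Countable G] {Λ : KGraph k} {S : SelfSimilarSys k G Λ}
  {T : Set Λ.Path} {x y z : InfPath Λ} {g h : G}

theorem IsGAct.unique (hy : S.IsGAct g x y) (hz : S.IsGAct g x z) : y = z :=
  InfPath.ext_zero fun n => by rw [hy, hz]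

theorem IsGAct.mul (hy : S.IsGAct g x y) (hz : S.IsGAct h y z) : S.IsGAct (h * g) x z :=
  fun n => by rw [hz, hy, S.act_mul]

theorem IsGAct.inv (hy : S.IsGAct g x y) : S.IsGAct g⁻¹ y x :=
  fun n => by rw [hy, ← S.act_mul, inv_mul_cancel, S.act_one]

theorem s_act_eq (hfix : ∀ g v, Λ.IsVertex v → S.act g v = v) (g : G) (μ : Λ.Path) :
    Λ.s (S.act g μ) = Λ.s μ := by
  rw [S.s_act, hfix _ _ (KGraph.isVertex_s μ)]

theorem r_act_eq (hfix : ∀ g v, Λ.IsVertex v → S.act g v = v) (g : G) (μ : Λ.Path) :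
    Λ.r (S.act g μ) = Λ.r μ := by
  rw [S.r_act, hfix _ _ (KGraph.isVertex_r μ)]

theorem exists_isGAct (hfix : ∀ g v, Λ.IsVertex v → S.act g v = v) (g : G) (x : InfPath Λ) :
    ∃ y : InfPath Λ, S.IsGAct g x y := by
  refine InfPath.exists_of_isPrefix (fun n => S.act g (x.val 0 n)) (fun n => ?_) fun m n => ?_
  · rw [S.d_act, x.d_val]
  · rw [← x.val_zero_add, S.act_comp _ _ _ (x.composable_zero m n)]
    exact KGraph.isPrefix_comp (by rw [s_act_eq hfix, r_act_eq hfix, x.composable_zero m n])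

theorem IsGAct.val_zero (hfix : ∀ g v, Λ.IsVertex v → S.act g v = v) (hy : S.IsGAct g x y)
    (n : Fin k → ℕ) : y.val n 0 = x.val n 0 := by
  have hy' := y.s_val 0 n
  rw [hy, s_act_eq hfix, x.s_val, zero_add] at hy'
  exact hy'.symm

theorem IsGAct.shift (hfix : ∀ g v, Λ.IsVertex v → S.act g v = v) (hy : S.IsGAct g x y)
    (n : Fin k → ℕ) : S.IsGAct (S.res g (x.val 0 n)) (x.shift n) (y.shift n) := by
  intro m
  change y.val (0 + n) m = S.act _ (x.val (0 + n) m)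
  rw [zero_add]
  refine (KGraph.comp_inj (y.composable_zero n m) ?_ (?_ : _ = Λ.d (S.act g (x.val 0 n))) ?_).2
  · rw [s_act_eq hfix, r_act_eq hfix, x.composable_zero n m]
  · rw [y.d_val, S.d_act, x.d_val]
  · rw [y.val_zero_add, ← S.act_comp _ _ _ (x.composable_zero n m), x.val_zero_add, hy]

theorem ClassMem.shift (hfix : ∀ g v, Λ.IsVertex v → S.act g v = v) (hy : S.ClassMem T x y)
    (n : Fin k → ℕ) : S.ClassMem T x (y.shift n) := by
  obtain ⟨hT, p, q, g, hg⟩ := hy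
  refine ⟨fun _ _ => hT _ _, n + p, q, ?_⟩
  have := hg.shift hfix n
  rw [InfPath.shift_shift, InfPath.shift_shift, add_comm n q] at this
  rw [InfPath.shift_shift]
  exact ⟨_, this⟩

theorem ClassMem.of_isGAct (hfix : ∀ g v, Λ.IsVertex v → S.act g v = v) (hy : S.ClassMem T x y)
    (hz : S.IsGAct g y z) : S.ClassMem T x z := by
  obtain ⟨hT, p, q, h, hh⟩ := hy
  refine ⟨?_, p, q, _, (hz.shift hfix q).inv.mul hh⟩
  rw [InfPath.inSub_tailPaths_iff] at hT ⊢
  intro n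
  rw [hz.val_zero hfix]
  exact hT n

theorem ClassMem.of_isExtension (hT : MaximalTail Λ T) {μ : Λ.Path} (hy : S.ClassMem T x y)
    (hz : Λ.IsExtension μ y z) : S.ClassMem T x z := by
  obtain ⟨hyT, p, q, h, hh⟩ := hy
  rw [← hz.shift_eq] at hyT hh
  rw [InfPath.shift_shift] at hh
  refine ⟨?_, p, _, h, hh⟩
  rw [InfPath.inSub_tailPaths_iff] at hyT ⊢
  intro n
  exact hT.backward_closed _ (z.isVertex_val n) _ (hyT n)
    ⟨z.val n (Λ.d μ), z.r_val _ _, z.s_val _ _⟩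

end SelfSimilarSys

namespace ClsIdx

variable {k : ℕ} {G : Type} [Group G] [Countable G] {Λ : KGraph k} {S : SelfSimilarSys k G Λ}
  {T : Set Λ.Path} {x : InfPath Λ}

/-- The partial bijection `y ↦ μy` of the class `[x]`. -/
noncomputable def prepend (hfix : ∀ g v, Λ.IsVertex v → S.act g v = v) (hT : MaximalTail Λ T)
    (x : InfPath Λ) (μ : Λ.Path) : ClsIdx S T x ≃. ClsIdx S T x where
  toFun y :=
    if h : Λ.s μ = y.1.val 0 0 then
      some ⟨(InfPath.exists_isExtension h).choose,
        y.2.of_isExtension hT (InfPath.exists_isExtension h).choose_spec⟩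
    else none
  invFun z := if z.1.val 0 (Λ.d μ) = μ then some ⟨z.1.shift (Λ.d μ), z.2.shift hfix _⟩ else none
  inv y z := by
    constructor
    · intro h
      split_ifs at h with hz
      have hyz := KGraph.isExtension_shift_of_eq hz
      have hy : z.1.shift (Λ.d μ) = y.1 := congrArg Subtype.val (Option.some.inj h)
      rw [hy] at hyz
      rw [dif_pos hyz.1]
      exact congrArg some (Subtype.ext ((InfPath.exists_isExtension hyz.1).choose_spec.unique hyz))
    · intro h
      split_ifs at h with hy
      have hyz := (InfPath.exists_isExtension hy).choose_spec
      have hz : (InfPath.exists_isExtension hy).choose = z.1 :=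
        congrArg Subtype.val (Option.some.inj h)
      rw [hz] at hyz
      rw [if_pos hyz.val_d]
      exact congrArg some (Subtype.ext hyz.shift_eq)

/-- The bijection `y ↦ g · y` of the class `[x]`. -/
noncomputable def translate (hfix : ∀ g v, Λ.IsVertex v → S.act g v = v) (T : Set Λ.Path)
    (x : InfPath Λ) (g : G) : ClsIdx S T x ≃ ClsIdx S T x where
  toFun y := ⟨(SelfSimilarSys.exists_isGAct hfix g y.1).choose,
    y.2.of_isGAct hfix (SelfSimilarSys.exists_isGAct hfix g y.1).choose_spec⟩
  invFun y := ⟨(SelfSimilarSys.exists_isGAct hfix g⁻¹ y.1).choose,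
    y.2.of_isGAct hfix (SelfSimilarSys.exists_isGAct hfix g⁻¹ y.1).choose_spec⟩
  left_inv y := Subtype.ext <|
    (SelfSimilarSys.exists_isGAct hfix g⁻¹ _).choose_spec.unique
      (SelfSimilarSys.exists_isGAct hfix g y.1).choose_spec.inv
  right_inv y := Subtype.ext <|
    (SelfSimilarSys.exists_isGAct hfix g _).choose_spec.unique <| by
      simpa using (SelfSimilarSys.exists_isGAct hfix g⁻¹ y.1).choose_spec.inv

variable (hfix : ∀ g v, Λ.IsVertex v → S.act g v = v) (hT : MaximalTail Λ T)

theorem translate_isGAct (g : G) (y : ClsIdx S T x) : S.IsGAct g y.1 (translate hfix T x g y).1 :=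
  (SelfSimilarSys.exists_isGAct hfix g y.1).choose_spec

theorem translate_mul (g h : G) :
    translate hfix T x (g * h) = (translate hfix T x h).trans (translate hfix T x g) :=
  Equiv.ext fun y => Subtype.ext <| (translate_isGAct hfix (g * h) y).unique <|
    (translate_isGAct hfix h y).mul (translate_isGAct hfix g _)

theorem prepend_eq_some_iff {μ : Λ.Path} {y z : ClsIdx S T x} :
    prepend hfix hT x μ y = some z ↔ Λ.IsExtension μ y.1 z.1 := by
  constructor
  · intro h
    change dite _ _ _ = _ at h
    split_ifs at h with hy
    rw [← Option.some.inj h]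
    exact (InfPath.exists_isExtension hy).choose_spec
  · intro h
    change dite _ _ _ = _
    rw [dif_pos h.1]
    exact congrArg some (Subtype.ext ((InfPath.exists_isExtension h.1).choose_spec.unique h))

theorem exists_prepend_eq_some {μ : Λ.Path} {y : ClsIdx S T x} (h : Λ.s μ = y.1.val 0 0) :
    ∃ z, prepend hfix hT x μ y = some z :=
  ⟨_, dif_pos h⟩

theorem prepend_eq_none {μ : Λ.Path} {y : ClsIdx S T x} (h : Λ.s μ ≠ y.1.val 0 0) :
    prepend hfix hT x μ y = none :=
  dif_neg h

theorem isSome_prepend_iff {μ : Λ.Path} {y : ClsIdx S T x} :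
    (prepend hfix hT x μ y).isSome ↔ Λ.s μ = y.1.val 0 0 := by
  rw [Option.isSome_iff_exists]
  exact ⟨fun ⟨_, h⟩ => ((prepend_eq_some_iff hfix hT).1 h).1, exists_prepend_eq_some hfix hT⟩

theorem isSome_prepend_symm_iff {μ : Λ.Path} {z : ClsIdx S T x} :
    ((prepend hfix hT x μ).symm z).isSome ↔ z.1.val 0 (Λ.d μ) = μ := by
  rw [Option.isSome_iff_exists]
  constructor
  · rintro ⟨y, h⟩
    rw [PEquiv.eq_some_iff, prepend_eq_some_iff] at h
    exact h.val_d
  · intro h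
    exact ⟨⟨z.1.shift (Λ.d μ), z.2.shift hfix _⟩, (PEquiv.eq_some_iff _).2 <|
      (prepend_eq_some_iff hfix hT).2 (KGraph.isExtension_shift_of_eq h)⟩

theorem prepend_comp {μ ν : Λ.Path} (h : Λ.s μ = Λ.r ν) :
    prepend hfix hT x (Λ.comp μ ν) = (prepend hfix hT x ν).trans (prepend hfix hT x μ) := by
  refine PEquiv.ext fun y => Option.ext fun z => ?_
  rw [PEquiv.trans_eq_some, prepend_eq_some_iff]
  simp only [prepend_eq_some_iff]
  constructor
  · intro hz
    have hy : Λ.s ν = y.1.val 0 0 := by rw [← hz.1, Λ.s_comp _ _ h]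
    obtain ⟨w, hw⟩ := exists_prepend_eq_some hfix hT hy
    rw [prepend_eq_some_iff] at hw
    obtain ⟨z', hz'⟩ := exists_prepend_eq_some hfix hT (y := w) (h.trans hw.val_zero.symm)
    rw [prepend_eq_some_iff] at hz'
    refine ⟨w, hw, ?_⟩
    rwa [hz.unique (hw.comp hz' h)]
  · rintro ⟨w, hw, hz⟩
    exact hw.comp hz h

theorem prepend_vertex {v : Λ.Path} (hv : Λ.IsVertex v) :
    prepend hfix hT x v = PEquiv.ofSet {y | y.1.val 0 0 = v} := by
  refine PEquiv.ext fun y => Option.ext fun z => ?_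
  rw [prepend_eq_some_iff, PEquiv.ofSet_eq_some_iff]
  constructor
  · intro h
    have hy : y.1.val 0 0 = v := by rw [← h.1, hv.s_eq]
    have h' := KGraph.isExtension_vertex y.1
    rw [hy] at h'
    have : z = y := Subtype.ext (h.unique h')
    subst this
    exact ⟨rfl, hy⟩
  · rintro ⟨rfl, hy⟩
    have h' := KGraph.isExtension_vertex z.1
    rwa [show z.1.val 0 0 = v from hy] at h'

theorem prepend_trans_symm (μ : Λ.Path) :
    (prepend hfix hT x μ).trans (prepend hfix hT x μ).symm = prepend hfix hT x (Λ.s μ) := by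
  rw [PEquiv.self_trans_symm, prepend_vertex hfix hT (KGraph.isVertex_s μ)]
  congr 1
  ext y
  exact (isSome_prepend_iff hfix hT).trans eq_comm

theorem prepend_symm_trans (μ : Λ.Path) :
    (prepend hfix hT x μ).symm.trans (prepend hfix hT x μ) =
      PEquiv.ofSet {z | z.1.val 0 (Λ.d μ) = μ} := by
  rw [PEquiv.symm_trans_self]
  congr 1
  ext y
  simp only [Set.mem_ofPred_eq, isSome_prepend_symm_iff]

theorem prepend_trans_prepend_of_ne {v w : Λ.Path} (hv : Λ.IsVertex v) (hw : Λ.IsVertex w)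
    (h : v ≠ w) : (prepend hfix hT x w).trans (prepend hfix hT x v) = ⊥ := by
  refine PEquiv.ext fun y => Option.ext fun z => ?_
  rw [PEquiv.trans_eq_some]
  simp only [prepend_eq_some_iff, PEquiv.bot_apply, reduceCtorEq, iff_false, not_exists, not_and]
  intro u hu hz
  have h₁ := hu.val_zero
  rw [← hz.1, hv.s_eq, hw.r_eq] at h₁
  exact h h₁

theorem prepend_trans_translate (g : G) (μ : Λ.Path) :
    (prepend hfix hT x μ).trans (translate hfix T x g).toPEquiv =
      (translate hfix T x (S.res g μ)).toPEquiv.trans (prepend hfix hT x (S.act g μ)) := by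
  have key : ∀ y z : ClsIdx S T x, Λ.IsExtension μ y.1 z.1 →
      Λ.IsExtension (S.act g μ) (translate hfix T x (S.res g μ) y).1
        (translate hfix T x g z).1 := by
    intro y z hz
    refine ⟨?_, fun n => ?_⟩
    · rw [SelfSimilarSys.s_act_eq hfix, hz.1, (translate_isGAct hfix _ y).val_zero hfix]
    · rw [S.d_act, translate_isGAct hfix, translate_isGAct hfix, hz.2,
        S.act_comp _ _ _ (by rw [hz.1, y.1.r_val])]
  refine PEquiv.ext fun y => ?_
  change (prepend hfix hT x μ y).bind (fun z => some (translate hfix T x g z)) =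
    prepend hfix hT x (S.act g μ) (translate hfix T x (S.res g μ) y)
  by_cases hy : Λ.s μ = y.1.val 0 0
  · obtain ⟨z, hz⟩ := exists_prepend_eq_some hfix hT hy
    rw [hz]
    rw [prepend_eq_some_iff] at hz
    exact ((prepend_eq_some_iff hfix hT).2 (key y z hz)).symm
  · rw [prepend_eq_none hfix hT hy, prepend_eq_none hfix hT]
    · rfl
    · rwa [SelfSimilarSys.s_act_eq hfix, (translate_isGAct hfix _ y).val_zero hfix]

end ClsIdx

/-- For a self-similar `k`-graph `(G, Λ)` with `g · v = v` for vertices, a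
maximal tail `T`, a cofinal infinite path `x` of `ΛT` and a homomorphism
`f : ℤ^k → 𝕋`: the formulas `S_μ δ_y = f(d μ) δ_{μ y}` (resp. `0`) and
`U_g δ_y = δ_{g · y}` define bounded operators on `ℓ²([x])`, the `S_μ` being
partial isometries and the `U_g` unitaries, satisfying the Cuntz--Krieger and
self-similarity relations. -/
theorem exists_bounded_operator_family
    {k : ℕ} (G : Type) [Group G] [Countable G] (Λ : KGraph k)
    (hRF : Λ.RowFinite) (hSF : Λ.SourceFree)
    (S : SelfSimilarSys k G Λ)
    (hfix : ∀ g v, Λ.IsVertex v → S.act g v = v)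
    (T : Set Λ.Path) (hT : MaximalTail Λ T)
    (x : InfPath Λ) (hx : x.inSub (Λ.tailPaths T))
    (hcof : ∀ v ∈ T, ∃ m : Fin k → ℕ, ∃ μ,
      Λ.r μ = v ∧ Λ.s μ = x.val m 0 ∧ Λ.s μ ∈ T)
    (f : (Fin k → ℤ) → ℂ) (hf0 : f 0 = 1)
    (hfadd : ∀ a b, f (a + b) = f a * f b) (hfnorm : ∀ a, ‖f a‖ = 1) :
    ∃ (SOp : Λ.Path → (ClsH S T x →L[ℂ] ClsH S T x))
      (UOp : G → (ClsH S T x →L[ℂ] ClsH S T x)),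
      -- S_μ δ_y = f(d μ) δ_{μ y} when s μ = y(0,0), and = 0 otherwise
      (∀ μ, Λ.s μ ∈ T → ∀ y : ClsIdx S T x,
        (Λ.s μ = y.1.val 0 0 →
          ∃ z : ClsIdx S T x, Λ.IsExtension μ y.1 z.1 ∧
            SOp μ (delta S T x y) = f (fun i => (Λ.d μ i : ℤ)) • delta S T x z) ∧
        (Λ.s μ ≠ y.1.val 0 0 → SOp μ (delta S T x y) = 0)) ∧
      -- U_g δ_y = δ_{g · y}
      (∀ (g : G) (y : ClsIdx S T x), ∃ z : ClsIdx S T x,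
        S.IsGAct g y.1 z.1 ∧ UOp g (delta S T x y) = delta S T x z) ∧
      -- each S_μ (μ ∈ ΛT) is a partial isometry
      (∀ μ, Λ.s μ ∈ T →
        SOp μ * ContinuousLinearMap.adjoint (SOp μ) * SOp μ = SOp μ) ∧
      -- each U_g is a unitary
      (∀ g : G, UOp g * ContinuousLinearMap.adjoint (UOp g) = 1 ∧
        ContinuousLinearMap.adjoint (UOp g) * UOp g = 1) ∧
      -- (1) the S_v, v ∈ T, are mutually orthogonal projections
      (∀ v ∈ T, SOp v * SOp v = SOp v ∧
        ContinuousLinearMap.adjoint (SOp v) = SOp v) ∧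
      (∀ v ∈ T, ∀ w ∈ T, v ≠ w → SOp v * SOp w = 0) ∧
      -- (2) S_{μν} = S_μ S_ν
      (∀ μ ν, Λ.s ν ∈ T → Λ.s μ = Λ.r ν → SOp (Λ.comp μ ν) = SOp μ * SOp ν) ∧
      -- (3) S_μ* S_μ = S_{s μ}
      (∀ μ, Λ.s μ ∈ T →
        ContinuousLinearMap.adjoint (SOp μ) * SOp μ = SOp (Λ.s μ)) ∧
      -- (4) S_v = ∑_{μ ∈ v Λ^p T} S_μ S_μ*
      (∀ v ∈ T, ∀ p : Fin k → ℕ, ∀ F : Finset Λ.Path,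
        (∀ μ, μ ∈ F ↔ (Λ.r μ = v ∧ Λ.d μ = p ∧ Λ.s μ ∈ T)) →
        SOp v = ∑ μ ∈ F, SOp μ * ContinuousLinearMap.adjoint (SOp μ)) ∧
      -- (5) U_{g h} = U_g U_h
      (∀ g h : G, UOp (g * h) = UOp g * UOp h) ∧
      -- (6) U_g S_μ = S_{g · μ} U_{g|_μ}
      (∀ (g : G) (μ : Λ.Path), Λ.s μ ∈ T →
        UOp g * SOp μ = SOp (S.act g μ) * UOp (S.res g μ)) := by
  have hf1 : ∀ a, (starRingEnd ℂ) (f a) * f a = 1 := fun a => by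
    rw [Complex.conj_mul', hfnorm]
    norm_num
  have hf1' : ∀ a, f a * (starRingEnd ℂ) (f a) = 1 := fun a => by rw [mul_comm, hf1]
  let c : Λ.Path → ℂ := fun μ => f fun i => (Λ.d μ i : ℤ)
  let e := ClsIdx.prepend hfix hT x
  let SOp : Λ.Path → (ClsH S T x →L[ℂ] ClsH S T x) := fun μ => c μ • (e μ).lpOperator
  let u := ClsIdx.translate hfix T x
  let UOp : G → (ClsH S T x →L[ℂ] ClsH S T x) := fun g => (u g).toPEquiv.lpOperator
  have hc : ∀ v, Λ.IsVertex v → c v = 1 := by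
    intro v hv
    have : (fun i => (Λ.d v i : ℤ)) = 0 := by
      funext i
      simp [show Λ.d v = 0 from hv]
    simp only [c, this, hf0]
  have hadj : ∀ μ, ContinuousLinearMap.adjoint (SOp μ) =
      (starRingEnd ℂ) (c μ) • (e μ).symm.lpOperator := by
    intro μ
    simp only [SOp, map_smulₛₗ, PEquiv.adjoint_lpOperator]
  have h2 : ∀ μ ν, Λ.s μ = Λ.r ν → SOp (Λ.comp μ ν) = SOp μ * SOp ν := by
    intro μ ν h
    have hcc : c (Λ.comp μ ν) = c μ * c ν := by
      simp only [c, ← hfadd, Λ.d_comp _ _ h]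
      congr 1
    simp only [SOp, e, hcc, ClsIdx.prepend_comp hfix hT h, PEquiv.lpOperator_trans,
      smul_mul_smul_comm]
  have h3 : ∀ μ, ContinuousLinearMap.adjoint (SOp μ) * SOp μ = SOp (Λ.s μ) := by
    intro μ
    rw [hadj]
    simp only [SOp, smul_mul_smul_comm, ← PEquiv.lpOperator_trans, c, hf1, e,
      ClsIdx.prepend_trans_symm]
    rw [show f _ = 1 from hc _ (KGraph.isVertex_s μ)]
  have h4 : ∀ μ, SOp μ * ContinuousLinearMap.adjoint (SOp μ) =
      (PEquiv.ofSet {z : ClsIdx S T x | z.1.val 0 (Λ.d μ) = μ}).lpOperator := by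
    intro μ
    rw [hadj]
    simp only [SOp, smul_mul_smul_comm, ← PEquiv.lpOperator_trans, c, hf1', e,
      ClsIdx.prepend_symm_trans, one_smul]
  have hv2 : ∀ v ∈ T, SOp v * SOp v = SOp v := by
    intro v hv
    have hvs := (hT.vertex v hv).s_eq
    rw [← h2 v v (hvs.trans (hT.vertex v hv).r_eq.symm)]
    congr 1
    simpa only [hvs] using Λ.comp_id v
  refine ⟨SOp, UOp, ?_, ?_, ?_, ?_, ?_, ?_, ?_, fun μ _ => h3 μ, ?_, ?_, ?_⟩
  · intro μ _ y
    refine ⟨fun h => ?_, fun h => ?_⟩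
    · obtain ⟨z, hz⟩ := ClsIdx.exists_prepend_eq_some hfix hT h
      refine ⟨z, (ClsIdx.prepend_eq_some_iff hfix hT).1 hz, ?_⟩
      exact congrArg (c μ • ·) (PEquiv.lpOperator_single_of_eq_some hz)
    · have := PEquiv.lpOperator_single_of_eq_none (ClsIdx.prepend_eq_none hfix hT h)
      exact (congrArg (c μ • ·) this).trans (smul_zero _)
  · intro g y
    exact ⟨u g y, ClsIdx.translate_isGAct hfix g y,
      PEquiv.lpOperator_single_of_eq_some (Equiv.toPEquiv_apply _ _)⟩
  · intro μ _
    rw [mul_assoc, h3, ← h2 _ _ (KGraph.isVertex_s μ).r_eq.symm, Λ.comp_id]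
  · intro g
    simp only [UOp, PEquiv.adjoint_lpOperator, ← PEquiv.lpOperator_trans, ← Equiv.toPEquiv_symm,
      ← Equiv.toPEquiv_trans, Equiv.self_trans_symm, Equiv.symm_trans_self, Equiv.toPEquiv_refl,
      PEquiv.lpOperator_refl, and_self]
  · intro v hv
    refine ⟨hv2 v hv, ?_⟩
    have h := h3 v
    rw [(hT.vertex v hv).s_eq] at h
    rw [← h, ← ContinuousLinearMap.star_eq_adjoint, ← ContinuousLinearMap.star_eq_adjoint,
      star_mul, star_star]
  · intro v hv w hw hvw
    simp only [SOp, e, smul_mul_smul_comm, ← PEquiv.lpOperator_trans,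
      ClsIdx.prepend_trans_prepend_of_ne hfix hT (hT.vertex v hv) (hT.vertex w hw) hvw,
      PEquiv.lpOperator_bot, smul_zero]
  · exact fun μ ν _ h => h2 μ ν h
  · intro v hv p F hF
    simp only [h4]
    ext ξ z
    have hL : SOp v = (PEquiv.ofSet {y : ClsIdx S T x | y.1.val 0 0 = v}).lpOperator := by
      simp only [SOp, hc v (hT.vertex v hv), one_smul, e,
        ClsIdx.prepend_vertex hfix hT (hT.vertex v hv)]
    rw [hL, _root_.sum_apply, lp.coeFn_sum, Finset.sum_apply]
    simp only [PEquiv.lpOperator_ofSet_apply, Set.mem_ofPred_eq]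
    have hmem : z.1.val 0 p ∈ F ↔ z.1.val 0 0 = v := by
      rw [hF, z.1.r_val, z.1.d_val]
      exact ⟨fun h => h.1, fun h => ⟨h, rfl, z.2.1 0 p⟩⟩
    rw [Finset.sum_congr rfl (g := fun μ => if z.1.val 0 p = μ then ξ z else 0)
      (fun μ hμ => by rw [((hF μ).1 hμ).2.1]), Finset.sum_ite_eq]
    simp only [hmem]
  · intro g h
    simp only [UOp, u, ClsIdx.translate_mul, Equiv.toPEquiv_trans, PEquiv.lpOperator_trans]
  · intro g μ _
    have hcc : c (S.act g μ) = c μ := by simp only [c, S.d_act]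
    simp only [SOp, UOp, hcc, mul_smul_comm, smul_mul_assoc, ← PEquiv.lpOperator_trans, e, u,
      ClsIdx.prepend_trans_translate]
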